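/- Let Q be a graph 3-connected along a bond d with both sides of d containing edges, and let L be the edge set of the left side. If the graph Q[L] is not 2-connected and has at least two edges, then (Q,d) is not irreducible. -/

import Mathlib

open SimpleGraph

/-- An edge set `X` is connected: any two vertices covered by `X` are joined by a path
consisting of edges of `X`.  (The empty edge set counts as connected.) -/
def EdgeSetConnected {V : Type*} (X : Set (Sym2 V)) : Prop :=
  ∀ u ∈ (fromEdgeSet X).support, ∀ v ∈ (fromEdgeSet X).support, (fromEdgeSet X).Reachable u v

/-- The subgraph `G[X]` spanned by an edge set `X`, as a graph on the covered vertices. -/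
def edgeSubgraph {V : Type*} (X : Set (Sym2 V)) :
    SimpleGraph ((fromEdgeSet X).support) :=
  (fromEdgeSet X).induce (fromEdgeSet X).support

/-- The number of connected components of `G[X]`. -/
noncomputable def edgeComponents {V : Type*} (X : Set (Sym2 V)) : ℕ :=
  Nat.card (edgeSubgraph X).ConnectedComponent

/-- A graph is `k`-connected if it has more than `k` vertices and deleting fewer than `k`
vertices always leaves a connected graph. -/
def KConnected {V : Type*} (k : ℕ) (G : SimpleGraph V) : Prop :=
  k < Nat.card V ∧ ∀ S : Set V, S.ncard < k → (G.induce Sᶜ).Connected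

/-- A constraint graph: a finite simple graph `G` together with a set `X` of edges. -/
structure CGraph : Type 1 where
  V : Type
  G : SimpleGraph V
  X : Set (Sym2 V)
  fin : Finite V := by infer_instance

attribute [instance] CGraph.fin

/-- `X` really is a set of edges of `G`. -/
def CGraph.WF (C : CGraph) : Prop := C.X ⊆ C.G.edgeSet

/-- The vertex map contracting `v` onto `u`. -/
noncomputable def contractFun {V : Type*} {u v : V} (huv : u ≠ v) (x : V) : {w : V // w ≠ v} :=
  letI := Classical.decEq V
  if h : x = v then ⟨u, huv⟩ else ⟨x, h⟩

/-- Contraction of a simple graph, identifying `v` with `u` (loops are discarded, parallel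
edges are merged, so the result is simple). -/
noncomputable def contractGraph {V : Type*} (G : SimpleGraph V) {u v : V} (huv : u ≠ v) :
    SimpleGraph {w : V // w ≠ v} :=
  fromEdgeSet (Sym2.map (contractFun huv) '' G.edgeSet)

/-- Contraction of a constraint graph: identify `v` with `u`; the new constraint consists of all
non-loop images of constraint edges; thus in each parallel class edges of `X` are preferred. -/
noncomputable def CGraph.contract (C : CGraph) (u v : C.V) (huv : u ≠ v) : CGraph where
  V := {w : C.V // w ≠ v}
  G := contractGraph C.G huv
  X := {e | e ∈ Sym2.map (contractFun huv) '' C.X ∧ ¬ e.IsDiag}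

/-- Deletion of an edge from a constraint graph. -/
def CGraph.deleteEdge (C : CGraph) (e : Sym2 C.V) : CGraph where
  V := C.V
  G := C.G.deleteEdges {e}
  X := C.X

/-- One step in forming a constraint minor: delete an edge not in `X`, or contract an edge. -/
inductive CMinorStep : CGraph → CGraph → Prop
  | del (C : CGraph) (e : Sym2 C.V) (he : e ∈ C.G.edgeSet) (hx : e ∉ C.X) :
      CMinorStep C (C.deleteEdge e)
  | contr (C : CGraph) (u v : C.V) (h : C.G.Adj u v) :
      CMinorStep C (C.contract u v h.ne)

/-- The constraint-minor relation. -/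
def IsCMinor : CGraph → CGraph → Prop := Relation.ReflTransGen CMinorStep

/-- Isomorphism of constraint graphs. -/
def CGIso (C D : CGraph) : Prop :=
  ∃ φ : C.G ≃g D.G, Sym2.map (⇑φ) '' C.X = D.X

/-- The constraint `K₄`. -/
def constraintK4 : CGraph where
  V := Fin 4
  G := ⊤
  X := {s(0, 1), s(2, 3)}

def wheelGraph : SimpleGraph (Fin 5) :=
  fromEdgeSet {s(0, 1), s(1, 2), s(2, 3), s(3, 0), s(0, 4), s(1, 4), s(2, 4), s(3, 4)}

/-- The constraint wheel. -/
def constraintWheel : CGraph where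
  V := Fin 5
  G := wheelGraph
  X := {s(0, 1), s(2, 3)}

/-- The prism `K₃ □ K₂`, with triangles `{0,1,2}` and `{3,4,5}`. -/
def prismGraph : SimpleGraph (Fin 6) :=
  fromEdgeSet {s(0, 1), s(1, 2), s(0, 2), s(3, 4), s(4, 5), s(3, 5), s(0, 3), s(1, 4), s(2, 5)}

def topEdges : Set (Sym2 (Fin 6)) := {s(0, 1), s(1, 2), s(0, 2)}
def botEdges : Set (Sym2 (Fin 6)) := {s(3, 4), s(4, 5), s(3, 5)}

/-- Constraint sets of the four constraint prisms: contained in the two triangles and meeting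
every vertex, inducing a spanning connected subgraph of each triangle. -/
def PrismConstraintSet (X : Set (Sym2 (Fin 6))) : Prop :=
  X ⊆ topEdges ∪ botEdges ∧
  EdgeSetConnected (X ∩ topEdges) ∧ (fromEdgeSet (X ∩ topEdges)).support = {0, 1, 2} ∧
  EdgeSetConnected (X ∩ botEdges) ∧ (fromEdgeSet (X ∩ botEdges)).support = {3, 4, 5}

/-- `C` is one of the four constraint prisms. -/
def IsConstraintPrism (C : CGraph) : Prop :=
  ∃ X, PrismConstraintSet X ∧ CGIso C (CGraph.mk (Fin 6) prismGraph X)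

/-- The six obstructions. -/
def IsObstruction (D : CGraph) : Prop :=
  CGIso D constraintK4 ∨ CGIso D constraintWheel ∨ IsConstraintPrism D

/-- The weird prism. -/
def weirdPrism : CGraph where
  V := Fin 6
  G := prismGraph
  X := {s(0, 3), s(1, 4), s(2, 5)}

/-- The Wagner graph `V₈`. -/
def wagnerGraph : SimpleGraph (Fin 8) :=
  fromEdgeSet {s(0, 1), s(1, 2), s(2, 3), s(3, 4), s(4, 5), s(5, 6), s(6, 7), s(7, 0),
    s(0, 4), s(1, 5), s(2, 6), s(3, 7)}

/-- The constraint Wagner graph: `X` is the complement of the 6-cycle `0-1-5-4-3-7-0`. -/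
def constraintWagner : CGraph where
  V := Fin 8
  G := wagnerGraph
  X := {s(1, 2), s(2, 3), s(5, 6), s(6, 7), s(0, 4), s(2, 6)}

/-- The Wagner prism. -/
def wagnerPrism : CGraph where
  V := Fin 6
  G := prismGraph
  X := {s(0, 3), s(1, 2), s(4, 5)}

/-- `(G, X)` has a 3-connected constraint minor whose constraint is disconnected. -/
def BadMinor (C : CGraph) : Prop :=
  ∃ C', IsCMinor C C' ∧ KConnected 3 C'.G ∧ ¬ EdgeSetConnected C'.X

/-- An edge `e ∉ X` is essential if neither `(G/e, X ∩ E(G/e))` nor `(G∖e, X)` has a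
3-connected constraint minor with disconnected constraint. -/
def Essential (C : CGraph) (e : Sym2 C.V) : Prop :=
  ¬ BadMinor (C.deleteEdge e) ∧
  ∀ u v, ∀ h : C.G.Adj u v, s(u, v) = e → ¬ BadMinor (C.contract u v h.ne)

/-- An edge joining two distinct components of `G[X]`. -/
def JoinsComponents {V : Type*} (X : Set (Sym2 V)) (e : Sym2 V) : Prop :=
  ∃ a b, e = s(a, b) ∧ a ∈ (fromEdgeSet X).support ∧ b ∈ (fromEdgeSet X).support ∧
    ¬ (fromEdgeSet X).Reachable a b

/-- The degree of a vertex. -/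
noncomputable def vdeg {V : Type*} (G : SimpleGraph V) (v : V) : ℕ := (G.neighborSet v).ncard

/-- The component of `G[X]` containing the edge `f` consists of the single edge `f`. -/
def SingleEdgeComponent {V : Type*} (X : Set (Sym2 V)) (f : Sym2 V) : Prop :=
  f ∈ X ∧ ∀ g ∈ X, (∃ a ∈ f, ∃ b ∈ g, (fromEdgeSet X).Reachable a b) → g = f

/-- The edges of `Q` with all endvertices in `S`: the edges of the side `Q[S]`. -/
def sideEdges {V : Type*} (Q : SimpleGraph V) (S : Set V) : Set (Sym2 V) :=
  {e | e ∈ Q.edgeSet ∧ ∀ v ∈ e, v ∈ S}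

/-- The edges of `Q` with one endvertex in `S` and one outside `S`. -/
def crossEdges {V : Type*} (Q : SimpleGraph V) (S : Set V) : Set (Sym2 V) :=
  {e | e ∈ Q.edgeSet ∧ (∃ v ∈ e, v ∈ S) ∧ ∃ v ∈ e, v ∉ S}

/-- `d` is a bond of `Q` with sides induced by `S` and `Sᶜ`. -/
def IsBondWith {V : Type*} (Q : SimpleGraph V) (d : Set (Sym2 V)) (S : Set V) : Prop :=
  S.Nonempty ∧ Sᶜ.Nonempty ∧ (Q.induce S).Connected ∧ (Q.induce Sᶜ).Connected ∧
    d = crossEdges Q S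

/-- `Q` is 3-connected along the bond `d` (with left side `S`): `Q` is 2-connected and no pair
of vertices, one from each side, separates `Q`. -/
def ThreeConnAlong {V : Type*} (Q : SimpleGraph V) (d : Set (Sym2 V)) (S : Set V) : Prop :=
  IsBondWith Q d S ∧ KConnected 2 Q ∧
    ∀ x ∈ S, ∀ y ∈ Sᶜ, (Q.induce ({x, y}ᶜ : Set V)).Preconnected

/-- One step of a special contraction minor: contract an edge not in the bond. -/
inductive SCMStep : CGraph → CGraph → Prop
  | contr (C : CGraph) (u v : C.V) (h : C.G.Adj u v) (hd : s(u, v) ∉ C.X) :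
      SCMStep C (C.contract u v h.ne)

/-- The special-contraction-minor relation. -/
def IsSCMinor : CGraph → CGraph → Prop := Relation.ReflTransGen SCMStep

/-- A proper (non-identical) special contraction minor. -/
def IsProperSCMinor : CGraph → CGraph → Prop := Relation.TransGen SCMStep

/-- The special `K₄`: `K₄` together with a bond of size 4. -/
def specialK4 : CGraph where
  V := Fin 4
  G := ⊤
  X := {s(0, 2), s(0, 3), s(1, 2), s(1, 3)}

/-- The special prism: the prism together with the bond complementing the two triangles. -/
def specialPrism : CGraph where
  V := Fin 6
  G := prismGraph
  X := {s(0, 3), s(1, 4), s(2, 5)}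

/-- `(Q, d)` is 3-connected along `d` and both sides of `d` contain edges. -/
def GoodAlong (C : CGraph) : Prop :=
  ∃ S : Set C.V, ThreeConnAlong C.G C.X S ∧
    (sideEdges C.G S).Nonempty ∧ (sideEdges C.G Sᶜ).Nonempty

/-- `(Q, d)` is irreducible. -/
def BondIrreducible (C : CGraph) : Prop :=
  (∃ S : Set C.V, ThreeConnAlong C.G C.X S) ∧
  ¬ ∃ C', IsProperSCMinor C C' ∧ GoodAlong C'

/-- An edge set forming a triangle. -/
def IsTriangle {V : Type*} (X : Set (Sym2 V)) : Prop :=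
  ∃ a b c : V, a ≠ b ∧ a ≠ c ∧ b ≠ c ∧ X = {s(a, b), s(b, c), s(a, c)}

/-- An edge set consisting of a single edge. -/
def IsSingleEdge {V : Type*} (X : Set (Sym2 V)) : Prop :=
  ∃ a b : V, a ≠ b ∧ X = {s(a, b)}

/-- `M` is (isomorphic to) the cycle matroid of `G`, via the bijection `f` between the ground
set of `M` and the edges of `G`: a set is independent iff its image is a forest. -/
def IsGraphicRep {α : Type} (M : Matroid α) {V : Type} (G : SimpleGraph V)
    (f : α → Sym2 V) : Prop :=
  Set.BijOn f M.E G.edgeSet ∧ ∀ I ⊆ M.E, (M.Indep I ↔ (fromEdgeSet (f '' I)).IsAcyclic)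

/-- The constraint matroid `(M, X)` is realisable. -/
def Realisable {α : Type} (M : Matroid α) (X : Set α) : Prop :=
  ∃ (V : Type) (_ : Finite V) (G : SimpleGraph V) (f : α → Sym2 V),
    IsGraphicRep M G f ∧ EdgeSetConnected (f '' X)

/-- Deletion of a set of elements from a matroid. -/
def Matroid.del {α : Type} (M : Matroid α) (D : Set α) : Matroid α := Matroid.restrict M (M.E \ D)

/-- Contraction of a set of elements of a matroid. -/
def Matroid.con {α : Type} (M : Matroid α) (C : Set α) : Matroid α :=
  Matroid.dual (Matroid.del (Matroid.dual M) C)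

/-- `(N, Y)` is a constraint minor of `(M, X)`: contract an arbitrary set `C` and delete a
set `D` of elements not in `X`. -/
def MatroidCMinor {α : Type} (M : Matroid α) (X : Set α) (N : Matroid α) (Y : Set α) : Prop :=
  ∃ C D : Set α, D ⊆ M.E \ X ∧ N = (M.con C).del D ∧ Y = X \ C

/-- `(N, Y)` is isomorphic, via the cycle matroid, to one of the six obstructions. -/
def MatroidObstruction {α : Type} (N : Matroid α) (Y : Set α) : Prop :=
  (∃ f : α → Sym2 (Fin 4), IsGraphicRep N constraintK4.G f ∧ f '' Y = constraintK4.X) ∨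
  (∃ f : α → Sym2 (Fin 5), IsGraphicRep N constraintWheel.G f ∧ f '' Y = constraintWheel.X) ∨
  (∃ X, PrismConstraintSet X ∧
    ∃ f : α → Sym2 (Fin 6), IsGraphicRep N prismGraph f ∧ f '' Y = X)


theorem walk_split {V : Type*} (G : SimpleGraph V) (e : Sym2 V) {a b : V} (p : G.Walk a b) :
    (∃ q : (G.deleteEdges {e}).Walk a b, ∀ w ∈ q.support, w ∈ p.support) ∨
    (∃ x y, s(x, y) = e ∧ ∃ q : (G.deleteEdges {e}).Walk a x,
      ∃ r : (G.deleteEdges {e}).Walk y b,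
      (∀ w ∈ q.support, w ∈ p.support) ∧ (∀ w ∈ r.support, w ∈ p.support)) := by
  induction p with
  | nil => exact Or.inl ⟨Walk.nil, by simp⟩
  | @cons a c b h p ih =>
    by_cases he : s(a, c) = e
    · rcases ih with ⟨q, hq⟩ | ⟨x, y, hxy, q, r, hq, hr⟩
      · refine Or.inr ⟨a, c, he, Walk.nil, q, ?_, ?_⟩
        · simp
        · intro w hw; simp [hq w hw]
      · rw [← he, Sym2.eq_iff] at hxy
        rcases hxy with ⟨rfl, rfl⟩ | ⟨rfl, rfl⟩
        · refine Or.inr ⟨x, y, he, Walk.nil, r, ?_, ?_⟩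
          · simp
          · intro w hw; simp [hr w hw]
        · exact Or.inl ⟨r, fun w hw => by simp [hr w hw]⟩
    · have h' : (G.deleteEdges {e}).Adj a c := by
        rw [deleteEdges_adj]; exact ⟨h, by simpa using he⟩
      rcases ih with ⟨q, hq⟩ | ⟨x, y, hxy, q, r, hq, hr⟩
      · refine Or.inl ⟨Walk.cons h' q, fun w hw => ?_⟩
        rw [Walk.support_cons, List.mem_cons] at hw ⊢
        exact hw.imp id (hq w)
      · refine Or.inr ⟨x, y, hxy, Walk.cons h' q, r, fun w hw => ?_, fun w hw => ?_⟩
        · rw [Walk.support_cons, List.mem_cons] at hw ⊢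
          exact hw.imp id (hq w)
        · simp [hr w hw]

theorem menger_half {V : Type*} (G : SimpleGraph V) (X Y : Set V) (x y z : V)
    (hG : ∀ t, ∃ a ∈ X, ∃ b ∈ Y, ∃ p : G.Walk a b, t ∉ p.support)
    (hz : ∀ a ∈ X, ∀ b ∈ Y, ∀ p : (G.deleteEdges {s(x, y)}).Walk a b, z ∈ p.support)
    {b0 : V} (hb0 : b0 ∈ Y) (r0 : (G.deleteEdges {s(x, y)}).Walk y b0) (hr0 : z ∉ r0.support) :
    ∀ t, ∃ a ∈ X, ∃ c ∈ ({z, x} : Set V),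
      ∃ p : (G.deleteEdges {s(x, y)}).Walk a c, t ∉ p.support := by
  classical
  intro t
  obtain ⟨a, ha, b, hb, p, hp⟩ := hG t
  rcases walk_split G s(x, y) p with ⟨q, hq⟩ | ⟨x', y', hxy, q, r, hq, hr⟩
  · have hzq := hz a ha b hb q
    exact ⟨a, ha, z, by simp, q.takeUntil z hzq,
      fun h => hp (hq _ (q.support_takeUntil_subset_support hzq h))⟩
  · rw [Sym2.eq_iff] at hxy
    rcases hxy with ⟨rfl, rfl⟩ | ⟨rfl, rfl⟩
    · exact ⟨a, ha, x', by simp, q, fun h => hp (hq _ h)⟩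
    · have hzq := hz a ha b0 hb0 (q.append r0)
      rw [Walk.mem_support_append_iff] at hzq
      have hzq := hzq.resolve_right hr0
      exact ⟨a, ha, z, by simp, q.takeUntil z hzq,
        fun h => hp (hq _ (q.support_takeUntil_subset_support hzq h))⟩

/-- two disjoint walks between `X` and `Y` -/
def TwoDisj {V : Type*} (G : SimpleGraph V) (X Y : Set V) : Prop :=
  ∃ x1 ∈ X, ∃ y1 ∈ Y, ∃ x2 ∈ X, ∃ y2 ∈ Y, ∃ p : G.Walk x1 y1, ∃ q : G.Walk x2 y2,
    ∀ w ∈ p.support, w ∉ q.support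

theorem TwoDisj.normal {V : Type*} {G : SimpleGraph V} {X : Set V} {z x : V}
    (h : TwoDisj G X {z, x}) :
    ∃ a1 ∈ X, ∃ a2 ∈ X, ∃ p : G.Walk a1 z, ∃ q : G.Walk a2 x,
      p.IsPath ∧ ∀ w ∈ p.support, w ∉ q.support := by
  classical
  have key : ∃ a1 ∈ X, ∃ a2 ∈ X, ∃ p : G.Walk a1 z, ∃ q : G.Walk a2 x,
      ∀ w ∈ p.support, w ∉ q.support := by
    obtain ⟨x1, h1, y1, hy1, x2, h2, y2, hy2, p, q, hpq⟩ := h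
    have hne : y1 ≠ y2 := by
      rintro rfl
      exact hpq _ p.end_mem_support q.end_mem_support
    simp only [Set.mem_insert_iff, Set.mem_singleton_iff] at hy1 hy2
    rcases hy1 with rfl | rfl <;> rcases hy2 with rfl | rfl
    · exact absurd rfl hne
    · exact ⟨x1, h1, x2, h2, p, q, hpq⟩
    · exact ⟨x2, h2, x1, h1, q, p, fun w hw hw' => hpq w hw' hw⟩
    · exact absurd rfl hne
  obtain ⟨a1, h1, a2, h2, p, q, hpq⟩ := key
  exact ⟨a1, h1, a2, h2, p.bypass, q, p.bypass_isPath,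
    fun w hw => hpq w (p.support_bypass_subset_support hw)⟩

theorem menger_two {V : Type*} [Finite V] [Nonempty V] (n : ℕ) :
    ∀ (G : SimpleGraph V) (X Y : Set V), G.edgeSet.ncard = n →
    (∀ t, ∃ a ∈ X, ∃ b ∈ Y, ∃ p : G.Walk a b, t ∉ p.support) → TwoDisj G X Y := by
  classical
  induction n using Nat.strong_induction_on with
  | _ n ih =>
  intro G X Y hn hG
  by_cases hE : ∃ x y, G.Adj x y
  swap
  · push Not at hE
    have key : ∀ t, ∃ a ∈ X, a ∈ Y ∧ t ≠ a := by
      intro t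
      obtain ⟨a, ha, b, hb, p, hp⟩ := hG t
      cases p with
      | nil => exact ⟨a, ha, hb, by simpa using hp⟩
      | cons h _ => exact absurd h (hE _ _)
    obtain ⟨a, ha, ha', -⟩ := key (Classical.arbitrary V)
    obtain ⟨b, hb, hb', hab⟩ := key a
    exact ⟨a, ha, a, ha', b, hb, b, hb', Walk.nil, Walk.nil, by simpa using hab⟩
  obtain ⟨x₀, y₀, hxy₀⟩ := hE
  have hlt : (G.deleteEdges {s(x₀, y₀)}).edgeSet.ncard < n := by
    rw [edgeSet_deleteEdges, ← hn]
    exact Set.ncard_sdiff_singleton_lt_of_mem (by simpa using hxy₀) (Set.toFinite _)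
  have hadj : ∀ x y, s(x, y) = s(x₀, y₀) → G.Adj x y := by
    intro x y h
    rw [← mem_edgeSet, h]
    exact hxy₀
  generalize s(x₀, y₀) = e at hlt hadj
  by_cases hG' : ∀ t, ∃ a ∈ X, ∃ b ∈ Y, ∃ p : (G.deleteEdges {e}).Walk a b, t ∉ p.support
  · obtain ⟨x1, h1, y1, hy1, x2, h2, y2, hy2, p, q, hpq⟩ := ih _ hlt _ X Y rfl hG'
    refine ⟨x1, h1, y1, hy1, x2, h2, y2, hy2, p.mapLe (deleteEdges_le _),
      q.mapLe (deleteEdges_le _), ?_⟩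
    simpa using hpq
  push Not at hG'
  obtain ⟨z, hz⟩ := hG'
  obtain ⟨a0, ha0, b0, hb0, p0, hp0⟩ := hG z
  rcases walk_split G e p0 with ⟨q, hq⟩ | ⟨x, y, hxy, q0, r0, hq0, hr0⟩
  · exact absurd (hq _ (hz _ ha0 _ hb0 q)) hp0
  subst hxy
  have hzq0 : z ∉ q0.support := fun h => hp0 (hq0 _ h)
  have hzr0 : z ∉ r0.support := fun h => hp0 (hr0 _ h)
  have hadj := hadj x y rfl
  have half1 := menger_half G X Y x y z hG hz hb0 r0 hzr0
  have half2 : ∀ t, ∃ a ∈ Y, ∃ c ∈ ({z, y} : Set V),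
      ∃ p : (G.deleteEdges {s(y, x)}).Walk a c, t ∉ p.support := by
    have hs : s(y, x) = s(x, y) := Sym2.eq_swap
    refine menger_half G Y X y x z ?_ ?_ ha0 (hs ▸ q0.reverse) ?_
    · intro t
      obtain ⟨a, ha, b, hb, p, hp⟩ := hG t
      exact ⟨b, hb, a, ha, p.reverse, by simpa using hp⟩
    · rw [hs]
      intro a ha b hb p
      simpa using hz b hb a ha p.reverse
    · clear * - hzq0
      generalize s(y, x) = e at *
      subst hs
      simpa using hzq0
  rw [Sym2.eq_swap] at half2
  obtain ⟨a1, ha1, a2, ha2, P1, P2, hP1, hP⟩ := (ih _ hlt _ X {z, x} rfl half1).normal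
  obtain ⟨b1, hb1, b2, hb2, Q1, Q2, hQ1, hQ⟩ := (ih _ hlt _ Y {z, y} rfl half2).normal
  generalize hH : G.deleteEdges {s(x, y)} = H at *
  have hle : H ≤ G := hH ▸ deleteEdges_le _
  have hzP2 : z ∉ P2.support := hP z P1.end_mem_support
  have hzQ2 : z ∉ Q2.support := hQ z Q1.end_mem_support
  -- the sets of vertices reached from either side avoiding `z` are disjoint
  have sepAB : ∀ a ∈ X, ∀ b ∈ Y, ∀ w, ∀ p : H.Walk a w, ∀ q : H.Walk b w,
      z ∉ p.support → z ∉ q.support → False := by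
    intro a ha b hb w p q hp hq
    have := hz a ha b hb (p.append q.reverse)
    rw [Walk.mem_support_append_iff] at this
    rcases this with h | h
    · exact hp h
    · exact hq (by simpa using h)
  have pre : ∀ {c d : V} (P : H.Walk c d) (w : V) (hw : w ∈ P.support), z ∉ P.support →
      ∃ p : H.Walk c w, z ∉ p.support := fun P w hw h =>
    ⟨P.takeUntil w hw, fun h' => h (P.support_takeUntil_subset_support hw h')⟩
  have pre' : ∀ {c : V} (P : H.Walk c z) (w : V) (hw : w ∈ P.support), P.IsPath → w ≠ z →
      ∃ p : H.Walk c w, z ∉ p.support := fun P w hw h hne =>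
    ⟨P.takeUntil w hw, Walk.endpoint_notMem_support_takeUntil h hw hne.symm⟩
  refine ⟨a1, ha1, b1, hb1, a2, ha2, b2, hb2, (P1.append Q1.reverse).mapLe hle,
    (P2.mapLe hle).append (Walk.cons hadj (Q2.reverse.mapLe hle)), ?_⟩
  intro w hw hw'
  have hw1 : w ∈ P1.support ∨ w ∈ Q1.support := by
    simpa [Walk.mem_support_append_iff] using hw
  have hw2 : w ∈ P2.support ∨ w ∈ Q2.support := by
    rw [Walk.mem_support_append_iff] at hw'
    rcases hw' with h | h
    · left; simpa using h
    · rw [Walk.support_cons, List.mem_cons] at h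
      rcases h with rfl | h
      · left; exact P2.end_mem_support
      · right; simpa using h
  have hwz : w ≠ z := by
    rintro rfl
    rcases hw2 with h | h
    · exact hzP2 h
    · exact hzQ2 h
  rcases hw1 with h1 | h1 <;> rcases hw2 with h2 | h2
  · exact hP w h1 h2
  · obtain ⟨p, hp⟩ := pre' P1 w h1 hP1 hwz
    obtain ⟨q, hq⟩ := pre Q2 w h2 hzQ2
    exact sepAB _ ha1 _ hb2 w p q hp hq
  · obtain ⟨p, hp⟩ := pre' Q1 w h1 hQ1 hwz
    obtain ⟨q, hq⟩ := pre P2 w h2 hzP2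
    exact sepAB _ ha2 _ hb1 w q p hq hp
  · exact hQ w h1 h2

theorem connected_partition {V : Type*} [Finite V] (G : SimpleGraph V) (hG : G.Preconnected)
    (X Y : Set V) (h : TwoDisj G X Y) :
    ∃ P : Set V, (G.induce P).Preconnected ∧ (G.induce Pᶜ).Preconnected ∧
      (∃ x ∈ X, x ∈ P) ∧ (∃ y ∈ Y, y ∈ P) ∧ (∃ x ∈ X, x ∉ P) ∧ (∃ y ∈ Y, y ∉ P) := by
  classical
  obtain ⟨x1, h1, y1, hy1, x2, h2, y2, hy2, p, q, hpq⟩ := h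
  let F : Set (Set V × Set V) := {T | (G.induce T.1).Preconnected ∧ (G.induce T.2).Preconnected ∧
    (∀ w ∈ T.1, w ∉ T.2) ∧ (∀ w ∈ p.support, w ∈ T.1) ∧ (∀ w ∈ q.support, w ∈ T.2)}
  have hF : F.Nonempty := ⟨({w | w ∈ p.support}, {w | w ∈ q.support}),
    p.connected_induce_support.preconnected, q.connected_induce_support.preconnected,
    hpq, fun w hw => hw, fun w hw => hw⟩
  obtain ⟨⟨P, Q⟩, ⟨hP, hQ, hPQ, hpP, hqQ⟩, hmax⟩ := (Set.toFinite F).exists_maximal hF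
  dsimp only at hP hQ hPQ hpP hqQ
  have hall : ∀ w, w ∈ P ∪ Q := by
    by_contra hcon
    push Not at hcon
    obtain ⟨w, hw⟩ := hcon
    obtain ⟨r⟩ := hG x1 w
    obtain ⟨d, -, hd1, hd2⟩ := r.exists_boundary_dart (P ∪ Q) (Or.inl (hpP _ p.start_mem_support)) hw
    have hs : (G.induce {d.snd}).Preconnected := by
      rintro ⟨a, ha⟩ ⟨b, hb⟩
      have : a = b := by rw [Set.mem_singleton_iff] at ha hb; rw [ha, hb]
      subst this
      exact Reachable.refl _
    simp only [Set.mem_union, not_or] at hd2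
    rcases hd1 with hd1 | hd1
    · have hmem : (P ∪ {d.snd}, Q) ∈ F := by
        refine ⟨(connected_induce_union hP hs hd1 rfl d.adj).preconnected, hQ, ?_, ?_, hqQ⟩
        · rintro w (hw | hw)
          · exact hPQ w hw
          · rw [Set.mem_singleton_iff] at hw; subst hw; exact hd2.2
        · exact fun w hw => Or.inl (hpP w hw)
      have := hmax hmem ⟨Set.subset_union_left, le_refl Q⟩
      exact hd2.1 (this.1 (Or.inr rfl))
    · have hmem : (P, Q ∪ {d.snd}) ∈ F := by
        refine ⟨hP, (connected_induce_union hQ hs hd1 rfl d.adj).preconnected, ?_, hpP, ?_⟩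
        · rintro w hw (hw' | hw')
          · exact hPQ w hw hw'
          · rw [Set.mem_singleton_iff] at hw'; subst hw'; exact hd2.1 hw
        · exact fun w hw => Or.inl (hqQ w hw)
      have := hmax hmem ⟨le_refl P, Set.subset_union_left⟩
      exact hd2.2 (this.2 (Or.inr rfl))
  have hQP : Q = Pᶜ := by
    ext w
    constructor
    · intro hw hw'; exact hPQ w hw' hw
    · intro hw; exact (hall w).resolve_left hw
  subst hQP
  exact ⟨P, hP, hQ, ⟨x1, h1, hpP _ p.start_mem_support⟩, ⟨y1, hy1, hpP _ p.end_mem_support⟩,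
    ⟨x2, h2, hqQ _ q.start_mem_support⟩, ⟨y2, hy2, hqQ _ q.end_mem_support⟩⟩

/-- The graph of edges inside fibres of `f`. -/
def fibreGraph {V : Type*} (G : SimpleGraph V) (f : V → Fin 4) : SimpleGraph V where
  Adj a b := G.Adj a b ∧ f a = f b
  symm := ⟨fun _ _ h => ⟨h.1.symm, h.2.symm⟩⟩
  loopless := ⟨fun _ h => h.1.ne rfl⟩

/-- `f` exhibits the special `K₄` as a special contraction minor. -/
structure K4Model (C : CGraph) (f : C.V → Fin 4) : Prop where
  cross : C.X = crossEdges C.G {w | f w < 2}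
  conn : ∀ a b, f a = f b → (fibreGraph C.G f).Reachable a b
  adj : ∀ i j, i ≠ j → ∃ a b, f a = i ∧ f b = j ∧ C.G.Adj a b

theorem contractGraph_adj {V : Type*} (G : SimpleGraph V) {u v : V} (huv : u ≠ v)
    (p q : {w : V // w ≠ v}) : (contractGraph G huv).Adj p q ↔
      p ≠ q ∧ ∃ x y, G.Adj x y ∧ contractFun huv x = p ∧ contractFun huv y = q := by
  unfold contractGraph
  rw [fromEdgeSet_adj, and_comm]
  refine and_congr Iff.rfl ?_
  constructor
  · rintro ⟨e, he, hpq⟩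
    induction e using Sym2.ind with
    | _ x y =>
      rw [Sym2.map_mk, Sym2.eq_iff] at hpq
      rcases hpq with ⟨h1, h2⟩ | ⟨h1, h2⟩
      · exact ⟨x, y, he, h1, h2⟩
      · exact ⟨y, x, G.adj_symm he, h2, h1⟩
  · rintro ⟨x, y, h, rfl, rfl⟩
    exact ⟨s(x, y), h, by simp⟩

theorem contractFun_of_ne {V : Type*} {u v : V} (huv : u ≠ v) (x : V) (hx : x ≠ v) :
    contractFun huv x = ⟨x, hx⟩ := by
  unfold contractFun; simp [hx]

theorem f_contractFun {V α : Type*} (f : V → α) {u v : V} (huv : u ≠ v) (hf : f u = f v) (x : V) :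
    f (contractFun huv x).1 = f x := by
  unfold contractFun
  by_cases h : x = v
  · simp [h, hf]
  · simp [h]

theorem mk_mem_crossEdges {V : Type*} (G : SimpleGraph V) (S : Set V) (x y : V) :
    s(x, y) ∈ crossEdges G S ↔ G.Adj x y ∧ ((x ∈ S ∧ y ∉ S) ∨ (x ∉ S ∧ y ∈ S)) := by
  unfold crossEdges
  simp only [Set.mem_ofPred_eq, mem_edgeSet, Sym2.mem_iff, exists_eq_or_imp, exists_eq_left]
  tauto

theorem K4Model.contract {C : CGraph} {f : C.V → Fin 4} (h : K4Model C f) {u v : C.V}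
    (huv : C.G.Adj u v) (hf : f u = f v) :
    K4Model (C.contract u v huv.ne) (fun w => f w.1) := by
  have hc := fun x => f_contractFun f huv.ne hf x
  refine ⟨?_, ?_, ?_⟩
  · have key : ∀ p q : {w : C.V // w ≠ v},
        (s(p, q) ∈ Sym2.map (contractFun huv.ne) '' C.X ∧ ¬ s(p, q).IsDiag) ↔
        (contractGraph C.G huv.ne).Adj p q ∧
          ((f p.1 < 2 ∧ ¬ f q.1 < 2) ∨ (¬ f p.1 < 2 ∧ f q.1 < 2)) := by
      intro p q
      rw [contractGraph_adj, Sym2.mk_isDiag_iff, h.cross]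
      constructor
      · rintro ⟨⟨e, he, hpq⟩, hne⟩
        induction e using Sym2.ind with
        | _ x y =>
        rw [mk_mem_crossEdges] at he
        rw [Sym2.map_mk, Sym2.eq_iff] at hpq
        obtain ⟨hxy, hS⟩ := he
        rcases hpq with ⟨rfl, rfl⟩ | ⟨rfl, rfl⟩
        · refine ⟨⟨hne, x, y, hxy, rfl, rfl⟩, ?_⟩
          simpa [hc] using hS
        · refine ⟨⟨hne, y, x, hxy.symm, rfl, rfl⟩, ?_⟩
          simp only [Set.mem_ofPred_eq, hc] at hS ⊢
          tauto
      · rintro ⟨⟨hne, x, y, hxy, rfl, rfl⟩, hS⟩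
        refine ⟨⟨s(x, y), ?_, by simp⟩, hne⟩
        rw [mk_mem_crossEdges]
        exact ⟨hxy, by simpa [hc] using hS⟩
    ext e
    induction e using Sym2.ind with
    | _ p q =>
      rw [mk_mem_crossEdges]
      exact key p q
  · intro a b hab
    have key : ∀ x y : C.V, (fibreGraph C.G f).Reachable x y →
        (fibreGraph (contractGraph C.G huv.ne) (fun w => f w.1)).Reachable
          (contractFun huv.ne x) (contractFun huv.ne y) := by
      rintro x y ⟨p⟩
      induction p with
      | nil => exact Reachable.refl _
      | @cons x y z hxy p ih =>
        refine Reachable.trans ?_ ih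
        by_cases heq : contractFun huv.ne x = contractFun huv.ne y
        · rw [heq]
        · refine Adj.reachable ⟨?_, ?_⟩
          · rw [contractGraph_adj]
            exact ⟨heq, x, y, hxy.1, rfl, rfl⟩
          · simpa [hc] using hxy.2
    have := key a.1 b.1 (h.conn _ _ hab)
    rw [contractFun_of_ne _ _ a.2, contractFun_of_ne _ _ b.2] at this
    exact this
  · intro i j hij
    obtain ⟨a, b, ha, hb, hadj⟩ := h.adj i j hij
    refine ⟨contractFun huv.ne a, contractFun huv.ne b, ?_, ?_, ?_⟩
    · simpa [hc] using ha
    · simpa [hc] using hb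
    · change (contractGraph C.G huv.ne).Adj _ _
      rw [contractGraph_adj]
      refine ⟨fun heq => hij ?_, a, b, hadj, rfl, rfl⟩
      rw [← ha, ← hb, ← hc a, ← hc b, heq]

theorem K4Model.step {C : CGraph} {f : C.V → Fin 4} (h : K4Model C f)
    (hf : ¬ Function.Injective f) :
    ∃ C1 : CGraph, SCMStep C C1 ∧ Nat.card C1.V < Nat.card C.V ∧ ∃ f1, K4Model C1 f1 := by
  unfold Function.Injective at hf
  push Not at hf
  obtain ⟨a, b, hab, hne⟩ := hf
  obtain ⟨p⟩ := h.conn a b hab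
  cases p with
  | nil => exact absurd rfl hne
  | @cons _ c _ hac p =>
    refine ⟨C.contract a c hac.1.ne, SCMStep.contr C a c hac.1 ?_, ?_, _, h.contract hac.1 hac.2⟩
    · rw [h.cross, mk_mem_crossEdges]
      simp [hac.2]
    · change Nat.card {w : C.V // w ≠ c} < _
      exact Finite.card_subtype_lt (x := c) (by simp)

theorem top_induce_preconnected {V : Type*} (U : Set V) :
    ((⊤ : SimpleGraph V).induce U).Preconnected := by
  intro a b
  by_cases hab : a = b
  · rw [hab]
  · exact Adj.reachable (by simpa [Subtype.ext_iff] using hab)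

theorem K4Model.good {C : CGraph} {f : C.V → Fin 4} (h : K4Model C f)
    (hf : Function.Injective f) : GoodAlong C := by
  have hs : Function.Surjective f := by
    intro i
    obtain ⟨a, b, ha, -⟩ := h.adj i (i + 1) (by revert i; decide)
    exact ⟨a, ha⟩
  have htop : C.G = ⊤ := by
    ext a b
    rw [top_adj]
    refine ⟨fun h => h.ne, fun hne => ?_⟩
    obtain ⟨a', b', ha, hb, hadj⟩ := h.adj (f a) (f b) (fun e => hne (hf e))
    rw [← hf ha, ← hf hb]
    exact hadj
  have hcard : Nat.card C.V = 4 := by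
    rw [Nat.card_congr (Equiv.ofBijective f ⟨hf, hs⟩)]; simp
  obtain ⟨v0, h0⟩ := hs 0
  obtain ⟨v1, h1⟩ := hs 1
  obtain ⟨v2, h2⟩ := hs 2
  obtain ⟨v3, h3⟩ := hs 3
  have m0 : v0 ∈ {w | f w < 2} := by simp [h0]
  have m1 : v1 ∈ {w | f w < 2} := by simp [h1]
  have m2 : v2 ∈ {w | f w < 2}ᶜ := by simp [h2]
  have m3 : v3 ∈ {w | f w < 2}ᶜ := by simp [h3]
  have n01 : v0 ≠ v1 := by rintro rfl; rw [h0] at h1; exact absurd h1 (by decide)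
  have n23 : v2 ≠ v3 := by rintro rfl; rw [h2] at h3; exact absurd h3 (by decide)
  refine ⟨{w | f w < 2}, ⟨⟨⟨v0, m0⟩, ⟨v2, m2⟩, ?_, ?_, h.cross⟩, ⟨by omega, ?_⟩, ?_⟩, ?_, ?_⟩
  · rw [htop]; exact (connected_iff _).2 ⟨top_induce_preconnected _, ⟨⟨v0, m0⟩⟩⟩
  · rw [htop]; exact (connected_iff _).2 ⟨top_induce_preconnected _, ⟨⟨v2, m2⟩⟩⟩
  · intro T hT
    rw [htop]
    refine (connected_iff _).2 ⟨top_induce_preconnected _, ?_⟩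
    by_contra hcon
    rw [Set.nonempty_coe_sort, Set.not_nonempty_iff_eq_empty, Set.compl_empty_iff] at hcon
    rw [hcon, Set.ncard_univ] at hT
    omega
  · intro x _ y _
    rw [htop]; exact top_induce_preconnected _
  · refine ⟨s(v0, v1), ?_, ?_⟩
    · rw [htop]; exact n01
    · intro v hv
      rcases Sym2.mem_iff.1 hv with rfl | rfl <;> assumption
  · refine ⟨s(v2, v3), ?_, ?_⟩
    · rw [htop]; exact n23
    · intro v hv
      rcases Sym2.mem_iff.1 hv with rfl | rfl <;> assumption

theorem K4Model.exists_good (n : ℕ) : ∀ (C : CGraph) (f : C.V → Fin 4), Nat.card C.V = n →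
    K4Model C f → ∃ C', IsSCMinor C C' ∧ GoodAlong C' := by
  induction n using Nat.strong_induction_on with
  | _ n ih =>
  intro C f hn h
  by_cases hf : Function.Injective f
  · exact ⟨C, Relation.ReflTransGen.refl, h.good hf⟩
  · obtain ⟨C1, hs, hlt, f1, h1⟩ := h.step hf
    obtain ⟨C', hm, hg⟩ := ih _ (hn ▸ hlt) C1 f1 rfl h1
    exact ⟨C', Relation.ReflTransGen.head hs hm, hg⟩

theorem K4Model.not_irreducible {C : CGraph} {f : C.V → Fin 4} (h : K4Model C f)
    (hf : ¬ Function.Injective f) : ¬ BondIrreducible C := by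
  rintro ⟨-, hno⟩
  obtain ⟨C1, hs, -, f1, h1⟩ := h.step hf
  obtain ⟨C', hm, hg⟩ := K4Model.exists_good _ C1 f1 rfl h1
  exact hno ⟨C', Relation.TransGen.head' hs hm, hg⟩

/-- The spanning subgraph of `G` with only the edges inside `U`. -/
def restr {V : Type*} (G : SimpleGraph V) (U : Set V) : SimpleGraph V where
  Adj a b := G.Adj a b ∧ a ∈ U ∧ b ∈ U
  symm := ⟨fun _ _ h => ⟨h.1.symm, h.2.2, h.2.1⟩⟩
  loopless := ⟨fun _ h => h.1.ne rfl⟩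

theorem restr_reachable {V : Type*} {G : SimpleGraph V} {U : Set V}
    (h : (G.induce U).Preconnected) {a b : V} (ha : a ∈ U) (hb : b ∈ U) :
    (restr G U).Reachable a b := by
  have := h ⟨a, ha⟩ ⟨b, hb⟩
  exact this.map (⟨fun x => x.1, fun {x y} hxy => ⟨hxy, x.2, y.2⟩⟩ : G.induce U →g restr G U)

theorem mk_mem_sideEdges {V : Type*} (G : SimpleGraph V) (S : Set V) (x y : V) :
    s(x, y) ∈ sideEdges G S ↔ G.Adj x y ∧ x ∈ S ∧ y ∈ S := by
  unfold sideEdges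
  simp

theorem side_adj {V : Type*} (G : SimpleGraph V) (S : Set V) (x y : V) :
    (fromEdgeSet (sideEdges G S)).Adj x y ↔ G.Adj x y ∧ x ∈ S ∧ y ∈ S := by
  rw [fromEdgeSet_adj, mk_mem_sideEdges]
  exact ⟨fun h => h.1, fun h => ⟨h, h.1.ne⟩⟩

theorem lift_reachable {V : Type*} (G : SimpleGraph V) (S U : Set V) (hU : U ⊆ S)
    (T : Set (fromEdgeSet (sideEdges G S)).support) (hT : ∀ p ∈ T, p.1 ∉ U)
    {a b : V} (r : (restr G U).Walk a b) :
    ∀ (ha : a ∈ (fromEdgeSet (sideEdges G S)).support) (ha' : ⟨a, ha⟩ ∈ Tᶜ)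
      (hb : b ∈ (fromEdgeSet (sideEdges G S)).support) (hb' : ⟨b, hb⟩ ∈ Tᶜ),
      ((edgeSubgraph (sideEdges G S)).induce Tᶜ).Reachable ⟨⟨a, ha⟩, ha'⟩ ⟨⟨b, hb⟩, hb'⟩ := by
  induction r with
  | nil => intros; exact Reachable.refl _
  | @cons a c b h r ih =>
    intro ha ha' hb hb'
    have hadj : (fromEdgeSet (sideEdges G S)).Adj a c :=
      (side_adj _ _ _ _).2 ⟨h.1, hU h.2.1, hU h.2.2⟩
    have hc : c ∈ (fromEdgeSet (sideEdges G S)).support := ⟨a, hadj.symm⟩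
    have hc' : (⟨c, hc⟩ : (fromEdgeSet (sideEdges G S)).support) ∈ Tᶜ := fun hcT => hT _ hcT h.2.2
    refine Reachable.trans (Adj.reachable ?_) (ih hc hc' hb hb')
    exact hadj

theorem exists_cut {V : Type*} [Finite V] (G : SimpleGraph V) (S : Set V)
    (hS : (G.induce S).Preconnected)
    (hn2 : ¬ KConnected 2 (edgeSubgraph (sideEdges G S)))
    (h2e : 2 ≤ (sideEdges G S).ncard) :
    ∃ v ∈ S, ∃ a ∈ S, ∃ b ∈ S, a ≠ v ∧ b ≠ v ∧ ¬ (restr G (S \ {v})).Reachable a b := by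
  have hsub : ∀ x ∈ (fromEdgeSet (sideEdges G S)).support, x ∈ S := by
    rintro x ⟨y, hy⟩
    exact ((side_adj _ _ _ _).1 hy).2.1
  have hcard : 2 < Nat.card (fromEdgeSet (sideEdges G S)).support := by
    rw [Nat.card_coe_set_eq, Set.two_lt_ncard_iff (Set.toFinite _)]
    obtain ⟨e1, e2, h1, h2, hne⟩ := (Set.one_lt_ncard_iff (Set.toFinite _)).1 h2e
    induction e1 using Sym2.ind with
    | _ a b =>
    induction e2 using Sym2.ind with
    | _ c d =>
    have hab : (fromEdgeSet (sideEdges G S)).Adj a b :=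
      (side_adj _ _ _ _).2 ((mk_mem_sideEdges _ _ _ _).1 h1)
    have hcd : (fromEdgeSet (sideEdges G S)).Adj c d :=
      (side_adj _ _ _ _).2 ((mk_mem_sideEdges _ _ _ _).1 h2)
    have hab' := hab.ne
    have hcd' := hcd.ne
    rw [Ne, Sym2.eq_iff] at hne
    by_cases hc : c = a ∨ c = b
    · refine ⟨a, b, d, ⟨b, hab⟩, ⟨a, hab.symm⟩, ⟨c, hcd.symm⟩, hab', ?_, ?_⟩ <;> grind
    · refine ⟨a, b, c, ⟨b, hab⟩, ⟨a, hab.symm⟩, ⟨d, hcd⟩, hab', ?_, ?_⟩ <;> grind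
  unfold KConnected at hn2
  push Not at hn2
  obtain ⟨T, hT, hnc⟩ := hn2 hcard
  have hne : Nonempty ↥(Tᶜ) := by
    by_contra hcon
    rw [Set.nonempty_coe_sort, Set.not_nonempty_iff_eq_empty, Set.compl_empty_iff] at hcon
    rw [hcon, Set.ncard_univ] at hT
    omega
  have hnp : ¬ ((edgeSubgraph (sideEdges G S)).induce Tᶜ).Preconnected :=
    fun hp => hnc ((connected_iff _).2 ⟨hp, hne⟩)
  unfold Preconnected at hnp
  push Not at hnp
  obtain ⟨⟨⟨a, ha⟩, ha'⟩, ⟨⟨b, hb⟩, hb'⟩, hab⟩ := hnp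
  rcases Set.eq_empty_or_nonempty T with hTe | ⟨⟨v, hv⟩, hvT⟩
  · exfalso
    obtain ⟨r⟩ := restr_reachable hS (hsub a ha) (hsub b hb)
    exact hab (lift_reachable G S S subset_rfl T (by simp [hTe]) r ha ha' hb hb')
  · refine ⟨v, hsub v hv, a, hsub a ha, b, hsub b hb, ?_, ?_, ?_⟩
    · rintro rfl; exact ha' hvT
    · rintro rfl; exact hb' hvT
    · rintro ⟨r⟩
      refine hab (lift_reachable G S (S \ {v}) Set.sdiff_subset T ?_ r ha ha' hb hb')
      intro p hp hpU
      have h1 : T.ncard ≤ 1 := by omega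
      have := (Set.ncard_le_one (Set.toFinite _)).1 h1 p hp _ hvT
      exact hpU.2 (by rw [this]; rfl)

theorem not_irreducible_of_cut (C : CGraph) (S : Set C.V) (h : ThreeConnAlong C.G C.X S)
    (v a b : C.V) (hv : v ∈ S) (ha : a ∈ S) (hb : b ∈ S) (hav : a ≠ v) (hbv : b ≠ v)
    (hab : ¬ (restr C.G (S \ {v})).Reachable a b) : ¬ BondIrreducible C := by
  classical
  obtain ⟨⟨-, hRne, hS, hR, hX⟩, -, h3⟩ := h
  set G := C.G with hGdef
  let A : Set C.V := {w | (restr G (S \ {v})).Reachable a w}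
  have haA : a ∈ A := Reachable.refl _
  have hbA : b ∉ A := hab
  have hcl : ∀ x y, x ∈ S → y ∈ S → x ≠ v → y ≠ v → G.Adj x y → x ∈ A → y ∈ A := by
    intro x y hx hy hxv hyv hxy hxA
    exact Reachable.trans hxA (Adj.reachable ⟨hxy, ⟨hx, hxv⟩, ⟨hy, hyv⟩⟩)
  have hAsub : ∀ w ∈ A, w ∈ S ∧ w ≠ v := by
    rintro w ⟨p⟩
    by_contra hcon
    obtain ⟨d, -, hd1, hd2⟩ := p.exists_boundary_dart {x | x ∈ S ∧ x ≠ v} ⟨ha, hav⟩ hcon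
    exact hd2 d.adj.2.2
  have hvA : v ∉ A := fun hh => (hAsub v hh).2 rfl
  let X : Set ↥(Sᶜ) := {r | ∃ w ∈ A, G.Adj w r.1}
  let Y : Set ↥(Sᶜ) := {r | ∃ w ∈ S, w ∉ A ∧ w ≠ v ∧ G.Adj w r.1}
  have hmeng : ∀ t : ↥(Sᶜ), ∃ x ∈ X, ∃ y ∈ Y, ∃ p : (G.induce Sᶜ).Walk x y, t ∉ p.support := by
    intro t
    have hpre := h3 v hv t.1 t.2
    have hat : a ≠ t.1 := fun e => t.2 (e ▸ ha)
    have hbt : b ≠ t.1 := fun e => t.2 (e ▸ hb)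
    obtain ⟨p⟩ := restr_reachable hpre (a := a) (b := b) (by simp [hav, hat]) (by simp [hbv, hbt])
    have key : ∀ {w c : C.V} (p : (restr G ({v, t.1}ᶜ : Set C.V)).Walk w c), c ∈ S → c ∉ A →
        (w ∈ A → ∃ x ∈ X, ∃ y ∈ Y, ∃ p : (G.induce Sᶜ).Walk x y, t ∉ p.support) ∧
        (∀ hw : w ∈ Sᶜ, (∃ x ∈ X, ∃ y ∈ Y, ∃ p : (G.induce Sᶜ).Walk x y, t ∉ p.support) ∨
          ∃ y ∈ Y, ∃ p : (G.induce Sᶜ).Walk ⟨w, hw⟩ y, t ∉ p.support) := by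
      intro w c p
      induction p with
      | nil => exact fun hc hcA => ⟨fun hh => absurd hh hcA, fun hh => absurd hc hh⟩
      | @cons w u c hwu p ih =>
        intro hc hcA
        obtain ⟨ih1, ih2⟩ := ih hc hcA
        obtain ⟨hadj, hw', hu'⟩ := hwu
        simp only [Set.mem_compl_iff, Set.mem_insert_iff, Set.mem_singleton_iff, not_or] at hw' hu'
        constructor
        · intro hwA
          by_cases huS : u ∈ S
          · exact ih1 (hcl w u (hAsub w hwA).1 huS hw'.1 hu'.1 hadj hwA)
          · rcases ih2 huS with hg | ⟨y, hy, q, hq⟩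
            · exact hg
            · exact ⟨⟨u, huS⟩, ⟨w, hwA, hadj⟩, y, hy, q, hq⟩
        · intro hw
          have hwt : t ≠ ⟨w, hw⟩ := fun e => hw'.2 (by rw [e])
          by_cases huS : u ∈ S
          · by_cases huA : u ∈ A
            · exact Or.inl (ih1 huA)
            · exact Or.inr ⟨⟨w, hw⟩, ⟨u, huS, huA, hu'.1, hadj.symm⟩, Walk.nil, by simpa using hwt⟩
          · rcases ih2 huS with hg | ⟨y, hy, q, hq⟩
            · exact Or.inl hg
            · have hadj2 : (G.induce Sᶜ).Adj ⟨w, hw⟩ ⟨u, huS⟩ := hadj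
              refine Or.inr ⟨y, hy, Walk.cons hadj2 q, ?_⟩
              rw [Walk.support_cons, List.mem_cons, not_or]
              exact ⟨hwt, hq⟩
    exact (key p hb hbA).1 haA
  have : Nonempty ↥(Sᶜ) := hRne.to_subtype
  obtain ⟨P, hP, hPc, ⟨x1, hx1, hx1P⟩, ⟨y1, hy1, hy1P⟩, ⟨x2, hx2, hx2P⟩, ⟨y2, hy2, hy2P⟩⟩ :=
    connected_partition (G.induce Sᶜ) hR.preconnected X Y (menger_two _ _ X Y rfl hmeng)
  let f : C.V → Fin 4 := fun w => if w ∈ S then (if w ∈ A then 0 else 1) else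
    if ∃ hw : w ∈ Sᶜ, ⟨w, hw⟩ ∈ P then 2 else 3
  have f0 : ∀ w ∈ A, f w = 0 := fun w hw => by simp [f, (hAsub w hw).1, hw]
  have f1 : ∀ w ∈ S, w ∉ A → f w = 1 := fun w hw hw' => by simp [f, hw, hw']
  have f2 : ∀ w : ↥(Sᶜ), w ∈ P → f w.1 = 2 := fun w hw => by
    have h1 : w.1 ∉ S := w.2
    have h2 : ∃ hw : w.1 ∈ Sᶜ, (⟨w.1, hw⟩ : ↥(Sᶜ)) ∈ P := ⟨w.2, hw⟩
    simp only [f]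
    rw [if_neg h1, if_pos h2]
  have f3 : ∀ w : ↥(Sᶜ), w ∉ P → f w.1 = 3 := fun w hw => by
    have h1 : w.1 ∉ S := w.2
    have h2 : ¬ ∃ hw : w.1 ∈ Sᶜ, (⟨w.1, hw⟩ : ↥(Sᶜ)) ∈ P := fun ⟨_, hh⟩ => hw hh
    simp only [f]
    rw [if_neg h1, if_neg h2]
  have fcases : ∀ w, (w ∈ A ∧ f w = 0) ∨ (w ∈ S ∧ w ∉ A ∧ f w = 1) ∨
      (∃ hw : w ∈ Sᶜ, ⟨w, hw⟩ ∈ P ∧ f w = 2) ∨ (∃ hw : w ∈ Sᶜ, ⟨w, hw⟩ ∉ P ∧ f w = 3) := by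
    intro w
    by_cases hwS : w ∈ S
    · by_cases hwA : w ∈ A
      · exact Or.inl ⟨hwA, f0 w hwA⟩
      · exact Or.inr (Or.inl ⟨hwS, hwA, f1 w hwS hwA⟩)
    · by_cases hwP : (⟨w, hwS⟩ : ↥(Sᶜ)) ∈ P
      · exact Or.inr (Or.inr (Or.inl ⟨hwS, hwP, f2 _ hwP⟩))
      · exact Or.inr (Or.inr (Or.inr ⟨hwS, hwP, f3 _ hwP⟩))
  have hSf : S = {w | f w < 2} := by
    ext w
    change w ∈ S ↔ f w < 2
    rcases fcases w with ⟨hw, e⟩ | ⟨hw, -, e⟩ | ⟨hw, -, e⟩ | ⟨hw, -, e⟩ <;> rw [e]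
    · exact iff_of_true (hAsub w hw).1 (by decide)
    · exact iff_of_true hw (by decide)
    · exact iff_of_false hw (by decide)
    · exact iff_of_false hw (by decide)
  -- connectivity of the fibres
  have c0 : ∀ w ∈ A, (fibreGraph G f).Reachable a w := by
    have key : ∀ {x w : C.V} (p : (restr G (S \ {v})).Walk x w), x ∈ A →
        (fibreGraph G f).Reachable x w := by
      intro x w p
      induction p with
      | nil => intro _; exact Reachable.refl _
      | @cons x y w hxy p ih =>
        intro hx
        have hy : y ∈ A := Reachable.trans hx (Adj.reachable hxy)
        exact Reachable.trans (Adj.reachable ⟨hxy.1, by rw [f0 x hx, f0 y hy]⟩) (ih hy)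
    rintro w ⟨p⟩
    exact key p haA
  have c1 : ∀ w ∈ S, w ∉ A → (fibreGraph G f).Reachable w v := by
    have key : ∀ {x w : C.V} (p : (restr G S).Walk x w), w = v → x ∉ A →
        (fibreGraph G f).Reachable x v := by
      intro x w p
      induction p with
      | nil => rintro rfl _; exact Reachable.refl _
      | @cons x y w hxy p ih =>
        intro hwv hx
        by_cases hxv : x = v
        · rw [hxv]
        have hy : y ∉ A := fun hyA =>
          hx (hcl y x hxy.2.2 hxy.2.1 (hAsub y hyA).2 hxv hxy.1.symm hyA)
        exact Reachable.trans
          (Adj.reachable ⟨hxy.1, by rw [f1 x hxy.2.1 hx, f1 y hxy.2.2 hy]⟩) (ih hwv hy)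
    intro w hw hwA
    obtain ⟨p⟩ := restr_reachable hS.preconnected hw hv
    exact key p rfl hwA
  have c23 : ∀ (U : Set ↥(Sᶜ)) (i : Fin 4), (∀ w ∈ U, f w.1 = i) →
      ((G.induce Sᶜ).induce U).Preconnected → ∀ x y : ↥(Sᶜ), x ∈ U → y ∈ U →
      (fibreGraph G f).Reachable x.1 y.1 := by
    intro U i hU hpre x y hx hy
    exact (hpre ⟨x, hx⟩ ⟨y, hy⟩).map (⟨fun z => z.1.1, fun {z z'} hz =>
      ⟨hz, by rw [hU _ z.2, hU _ z'.2]⟩⟩ : (G.induce Sᶜ).induce U →g fibreGraph G f)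
  have hadj' : ∀ i j : Fin 4, i < j → ∃ x y, f x = i ∧ f y = j ∧ G.Adj x y := by
    have e01 : ∃ x y, f x = 0 ∧ f y = 1 ∧ G.Adj x y := by
      obtain ⟨p⟩ := restr_reachable hS.preconnected ha hv
      obtain ⟨d, -, hd1, hd2⟩ := p.exists_boundary_dart A haA hvA
      exact ⟨d.fst, d.snd, f0 _ hd1, f1 _ d.adj.2.2 hd2, d.adj.1⟩
    have e23 : ∃ x y, f x = 2 ∧ f y = 3 ∧ G.Adj x y := by
      obtain ⟨p⟩ := hR.preconnected x1 x2
      obtain ⟨d, -, hd1, hd2⟩ := p.exists_boundary_dart P hx1P hx2P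
      exact ⟨d.fst.1, d.snd.1, f2 _ hd1, f3 _ hd2, d.adj⟩
    have e02 : ∃ x y, f x = 0 ∧ f y = 2 ∧ G.Adj x y := by
      obtain ⟨w, hw, hadj⟩ := hx1
      exact ⟨w, x1.1, f0 _ hw, f2 _ hx1P, hadj⟩
    have e03 : ∃ x y, f x = 0 ∧ f y = 3 ∧ G.Adj x y := by
      obtain ⟨w, hw, hadj⟩ := hx2
      exact ⟨w, x2.1, f0 _ hw, f3 _ hx2P, hadj⟩
    have e12 : ∃ x y, f x = 1 ∧ f y = 2 ∧ G.Adj x y := by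
      obtain ⟨w, hw, hwA, -, hadj⟩ := hy1
      exact ⟨w, y1.1, f1 _ hw hwA, f2 _ hy1P, hadj⟩
    have e13 : ∃ x y, f x = 1 ∧ f y = 3 ∧ G.Adj x y := by
      obtain ⟨w, hw, hwA, -, hadj⟩ := hy2
      exact ⟨w, y2.1, f1 _ hw hwA, f3 _ hy2P, hadj⟩
    intro i j hij
    fin_cases i <;> fin_cases j <;>
      first
      | exact absurd hij (by decide)
      | assumption
  have hmodel : K4Model C f := by
    refine ⟨?_, ?_, ?_⟩
    · rw [hX, ← hSf]
    · intro x y hxy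
      rcases fcases x with ⟨hx, ex⟩ | ⟨hx, hx', ex⟩ | ⟨hx, hx', ex⟩ | ⟨hx, hx', ex⟩ <;>
      rcases fcases y with ⟨hy, ey⟩ | ⟨hy, hy', ey⟩ | ⟨hy, hy', ey⟩ | ⟨hy, hy', ey⟩ <;>
      first
      | exact absurd (ex.symm.trans (hxy.trans ey)) (by decide)
      | skip
      · exact (c0 x hx).symm.trans (c0 y hy)
      · exact (c1 x hx hx').trans (c1 y hy hy').symm
      · exact c23 P 2 f2 hP ⟨x, hx⟩ ⟨y, hy⟩ hx' hy'
      · exact c23 Pᶜ 3 f3 hPc ⟨x, hx⟩ ⟨y, hy⟩ hx' hy'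
    · intro i j hij
      rcases lt_or_gt_of_ne hij with hlt | hlt
      · exact hadj' i j hlt
      · obtain ⟨x, y, hx, hy, hxy⟩ := hadj' j i hlt
        exact ⟨y, x, hy, hx, hxy.symm⟩
  refine hmodel.not_irreducible fun hinj => hbv (hinj ?_)
  rw [f1 b hb hbA, f1 v hv hvA]

/-- **Lemma (not_2_con).** If `Q[L]` is not 2-connected and has at least two edges, then
`(Q, d)` is not irreducible. -/
theorem not_two_connected_side (C : CGraph) (S : Set C.V) (h : ThreeConnAlong C.G C.X S)
    (hL : (sideEdges C.G S).Nonempty) (hR : (sideEdges C.G Sᶜ).Nonempty)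
    (hn2 : ¬ KConnected 2 (edgeSubgraph (sideEdges C.G S)))
    (h2e : 2 ≤ (sideEdges C.G S).ncard) :
    ¬ BondIrreducible C := by
  obtain ⟨v, hv, a, ha, b, hb, hav, hbv, hab⟩ := exists_cut C.G S h.1.2.2.1.preconnected hn2 h2e
  exact not_irreducible_of_cut C S h v a b hv ha hb hav hbv hab
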